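/- In the off-policy setting with an i.i.d. sample, suppose |Y| ≤ B almost surely and let τ : 𝒳 → ℝ be measurable with atomless law under P_X. For g ∈ (0,1) let π^g(x) := 1{τ(x) > κ_{1−g}} with κ_m := inf{t ∈ ℝ : P_X({x : τ(x) ≤ t}) ≥ m}, and let f_g(x,w,y) := η_{π^g}(x) + (π^g_w(x)/e_w(x))·(y − η(w,x)) be the associated doubly robust score. Then the uniform deviation D_n := sup_{g∈(0,1)} | (1/n) Σ_{i=1}^n f_g(X_i, W_i, Y_i) − ∫_𝒳 ( π^g(x)·η(1,x) + (1−π^g(x))·η(0,x) ) dP_X(x) | satisfies D_n = O_p(n^{−1/2}). -/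

import Mathlib

open MeasureTheory

/-- The `m`-quantile of the pushforward of `PX` under `f`:
`κ_m = inf {t : P_X(f ≤ t) ≥ m}`. -/
noncomputable def quantileOf {𝒳 : Type*} [MeasurableSpace 𝒳] (PX : Measure 𝒳)
    (f : 𝒳 → ℝ) (m : ℝ) : ℝ :=
  sInf {t : ℝ | ENNReal.ofReal m ≤ PX {x | f x ≤ t}}

/-- The threshold policy `π^g(x) = 1{τ(x) > κ_{1−g}}`. -/
noncomputable def thrPol {𝒳 : Type*} [MeasurableSpace 𝒳] (PX : Measure 𝒳)
    (τ : 𝒳 → ℝ) (g : ℝ) (x : 𝒳) : ℝ :=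
  if quantileOf PX τ (1 - g) < τ x then 1 else 0

/-- The doubly robust score of the threshold policy `π^g`, as a function of a
data point `z = (x, w, y)`. -/
noncomputable def drScoreThr {𝒳 : Type*} [MeasurableSpace 𝒳] (PX : Measure 𝒳)
    (e : 𝒳 → ℝ) (η : Bool → 𝒳 → ℝ) (τ : 𝒳 → ℝ) (g : ℝ)
    (z : 𝒳 × Bool × ℝ) : ℝ :=
  (thrPol PX τ g z.1 * η true z.1 + (1 - thrPol PX τ g z.1) * η false z.1) +
    ((if z.2.1 then thrPol PX τ g z.1 else 1 - thrPol PX τ g z.1) /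
        (if z.2.1 then e z.1 else 1 - e z.1)) *
      (z.2.2 - η z.2.1 z.1)

/-- The sign `±1` encoded by a Boolean. -/
def boolSign (s : Bool) : ℝ := if s then 1 else -1

lemma boolSign_not (s : Bool) : boolSign (!s) = -boolSign s := by
  cases s <;> simp [boolSign]

lemma boolSign_sq (s : Bool) : boolSign s ^ 2 = 1 := by
  cases s <;> simp [boolSign]

lemma sum_boolSign_mul_eq_zero {ι : Type*} [Fintype ι] [DecidableEq ι] (j : ι)
    (F : (ι → Bool) → ℝ) (hF : ∀ σ s, F (Function.update σ j s) = F σ) :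
    ∑ σ : ι → Bool, boolSign (σ j) * F σ = 0 := by
  refine Finset.sum_involution (fun σ _ => Function.update σ j (!σ j)) ?_ ?_ ?_ ?_
  · intro σ _
    simp [hF, boolSign_not]
  · intro σ _ _ h
    have := congrFun h j
    simp at this
  · simp
  · simp

/-- Doob's `L²` maximal inequality for Rademacher sums ordered by decreasing `τ`, together
with the information needed to add one more summand. -/
lemma exists_rademacher_maximal {ι : Type*} [Fintype ι] [DecidableEq ι] (τ b : ι → ℝ)
    (s : Finset ι) :
    ∃ M : (ι → Bool) → ℝ, (∀ σ, 0 ≤ M σ) ∧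
      (∀ j ∉ s, ∀ σ v, M (Function.update σ j v) = M σ) ∧
      (∀ σ t, ∑ i ∈ s, boolSign (σ i) * (if t < τ i then b i else 0) ≤ M σ) ∧
      ∑ σ : ι → Bool, ((2 * ∑ i ∈ s, boolSign (σ i) * b i - M σ) ^ 2 + M σ ^ 2) ≤
        2 ^ Fintype.card ι * (4 * ∑ i ∈ s, b i ^ 2) := by
  induction s using Finset.induction_on_min_value τ with
  | empty => exact ⟨fun _ => 0, by simp⟩
  | insert j s hj hmin ih =>
    obtain ⟨M, hM0, hMj, hMt, hMs⟩ := ih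
    set S : (ι → Bool) → ℝ := fun σ => ∑ i ∈ s, boolSign (σ i) * b i
    have hSup : ∀ k ∉ s, ∀ σ v, S (Function.update σ k v) = S σ := by
      intro k hk σ v
      refine Finset.sum_congr rfl fun i hi => ?_
      rw [Function.update_of_ne]
      rintro rfl
      exact hk hi
    refine ⟨fun σ => max (M σ) (boolSign (σ j) * b j + S σ), fun σ => le_max_of_le_left (hM0 σ),
      ?_, ?_, ?_⟩
    · intro k hk σ v
      rw [Finset.mem_insert, not_or] at hk
      simp only [hMj k hk.2, hSup k hk.2, Function.update_of_ne (Ne.symm hk.1)]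
    · intro σ t
      rw [Finset.sum_insert hj]
      by_cases ht : t < τ j
      · refine le_max_of_le_right (le_of_eq ?_)
        rw [if_pos ht]
        congr 1
        exact Finset.sum_congr rfl fun i hi => by rw [if_pos (ht.trans_le (hmin i hi))]
      · rw [if_neg ht]
        exact le_max_of_le_left (by simpa using hMt σ t)
    · have hpt : ∀ σ, (2 * ∑ i ∈ insert j s, boolSign (σ i) * b i -
            max (M σ) (boolSign (σ j) * b j + S σ)) ^ 2 +
            max (M σ) (boolSign (σ j) * b j + S σ) ^ 2 ≤
          ((2 * S σ - M σ) ^ 2 + M σ ^ 2) + 4 * b j ^ 2 +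
            boolSign (σ j) * (4 * b j * (2 * S σ - M σ)) := by
        intro σ
        rw [Finset.sum_insert hj]
        change (2 * (boolSign (σ j) * b j + S σ) - _) ^ 2 + _ ≤ _
        have h1 := boolSign_sq (σ j)
        have h2 : (2 * (boolSign (σ j) * b j + S σ) - M σ) ^ 2 + M σ ^ 2 =
          ((2 * S σ - M σ) ^ 2 + M σ ^ 2) + 4 * b j ^ 2 +
            boolSign (σ j) * (4 * b j * (2 * S σ - M σ)) := by
          linear_combination 4 * b j ^ 2 * h1
        rw [← h2]
        rcases le_total (M σ) (boolSign (σ j) * b j + S σ) with h | h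
        · rw [max_eq_right h]
          nlinarith [sq_nonneg (boolSign (σ j) * b j + S σ - M σ)]
        · rw [max_eq_left h]
      refine (Finset.sum_le_sum fun σ _ => hpt σ).trans ?_
      rw [Finset.sum_add_distrib, Finset.sum_add_distrib,
        sum_boolSign_mul_eq_zero j (fun σ => 4 * b j * (2 * S σ - M σ))
          (fun σ v => by rw [hSup j hj, hMj j hj]), Finset.sum_insert hj]
      simp only [Finset.sum_const, Finset.card_univ, Fintype.card_fun, Fintype.card_bool,
        nsmul_eq_mul]
      push_cast
      linarith

lemma sum_iSup_enorm_rademacher_le {ι κ : Type*} [Fintype ι] [DecidableEq ι]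
    (τ b : ι → ℝ) (u : κ → ℝ)
    {c : ℝ} (hc : 0 < c) :
    ∑ σ : ι → Bool, ⨆ k, ‖∑ i, boolSign (σ i) * (if u k < τ i then b i else 0)‖ₑ ≤
      2 ^ Fintype.card ι * ENNReal.ofReal (4 * (∑ i, b i ^ 2) / c + c) := by
  obtain ⟨M, hM0, -, hMt, hMs⟩ := exists_rademacher_maximal τ b Finset.univ
  obtain ⟨M', hM0', -, hMt', hMs'⟩ := exists_rademacher_maximal τ (fun i => -b i) Finset.univ
  have hpt : ∀ σ, ⨆ k, ‖∑ i, boolSign (σ i) * (if u k < τ i then b i else 0)‖ₑ ≤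
      ENNReal.ofReal (M σ + M' σ) := by
    intro σ
    refine iSup_le fun k => ?_
    rw [Real.enorm_eq_ofReal_abs]
    refine ENNReal.ofReal_le_ofReal (abs_le.2 ⟨?_, ?_⟩)
    · have h := hMt' σ (u k)
      have : ∑ i, boolSign (σ i) * (if u k < τ i then -b i else 0) =
          -∑ i, boolSign (σ i) * (if u k < τ i then b i else 0) := by
        rw [← Finset.sum_neg_distrib]
        exact Finset.sum_congr rfl fun i _ => by split_ifs <;> ring
      rw [this] at h
      linarith [hM0 σ]
    · linarith [hMt σ (u k), hM0' σ]
  refine (Finset.sum_le_sum fun σ _ => hpt σ).trans ?_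
  rw [← ENNReal.ofReal_sum_of_nonneg fun σ _ => add_nonneg (hM0 σ) (hM0' σ)]
  have h2 : (2 : ENNReal) ^ Fintype.card ι = ENNReal.ofReal (2 ^ Fintype.card ι) := by
    rw [ENNReal.ofReal_pow zero_le_two]; simp
  rw [h2, ← ENNReal.ofReal_mul (by positivity)]
  refine ENNReal.ofReal_le_ofReal ?_
  have hyoung : ∀ σ, M σ + M' σ ≤ (M σ ^ 2 + M' σ ^ 2) / (2 * c) + c := by
    intro σ
    have : (M σ ^ 2 + M' σ ^ 2) / (2 * c) + c - (M σ + M' σ) =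
        ((M σ - c) ^ 2 + (M' σ - c) ^ 2) / (2 * c) := by
      field_simp; ring
    have h3 : 0 ≤ ((M σ - c) ^ 2 + (M' σ - c) ^ 2) / (2 * c) := by positivity
    linarith
  have hsq : ∑ σ, (M σ ^ 2 + M' σ ^ 2) ≤ 2 ^ Fintype.card ι * (8 * ∑ i, b i ^ 2) := by
    have h4 := (Finset.sum_le_sum fun σ _ => le_add_of_nonneg_left (sq_nonneg _)).trans hMs
    have h5 := (Finset.sum_le_sum fun σ _ => le_add_of_nonneg_left (sq_nonneg _)).trans hMs'
    simp only [neg_sq] at h5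
    rw [Finset.sum_add_distrib]
    linarith
  calc ∑ σ, (M σ + M' σ) ≤ ∑ σ : ι → Bool, ((M σ ^ 2 + M' σ ^ 2) / (2 * c) + c) :=
        Finset.sum_le_sum fun σ _ => hyoung σ
    _ = (∑ σ, (M σ ^ 2 + M' σ ^ 2)) / (2 * c) + 2 ^ Fintype.card ι * c := by
        rw [Finset.sum_add_distrib, Finset.sum_div]
        simp
    _ ≤ (2 ^ Fintype.card ι * (8 * ∑ i, b i ^ 2)) / (2 * c) + 2 ^ Fintype.card ι * c := by
        gcongr
    _ = 2 ^ Fintype.card ι * (4 * (∑ i, b i ^ 2) / c + c) := by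
        field_simp; ring

/-- Symmetrization: the expected supremum of a centred empirical process over a countable class
is at most twice that of its Rademacher symmetrization. -/
lemma lintegral_iSup_enorm_centered_le {Z κ : Type*} [MeasurableSpace Z] [Countable κ]
    (Q : Measure Z) [IsProbabilityMeasure Q] (n : ℕ) (h : κ → Z → ℝ)
    (hm : ∀ k, Measurable (h k)) (hi : ∀ k, Integrable (h k) Q) :
    2 ^ n * ∫⁻ ω, ⨆ k, ‖∑ i, (h k (ω i) - ∫ z, h k z ∂Q)‖ₑ ∂(Measure.pi fun _ : Fin n => Q) ≤
      2 * ∫⁻ ω, ∑ σ : Fin n → Bool, ⨆ k, ‖∑ i, boolSign (σ i) * h k (ω i)‖ₑ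
        ∂(Measure.pi fun _ : Fin n => Q) := by
  set P := Measure.pi fun _ : Fin n => Q
  set G : (Fin n → Bool) → (Fin n → Z × Z) → ENNReal := fun σ ζ =>
    ⨆ k, ‖∑ i, boolSign (σ i) * (h k (ζ i).1 - h k (ζ i).2)‖ₑ
  set G₁ : (Fin n → Bool) → (Fin n → Z) → ENNReal := fun σ ω =>
    ⨆ k, ‖∑ i, boolSign (σ i) * h k (ω i)‖ₑ
  set P₂ := Measure.pi fun _ : Fin n => Q.prod Q
  have hGm : ∀ σ, Measurable (G σ) := fun σ => by
    refine Measurable.iSup fun k => (Finset.measurable_sum _ fun i _ => ?_).enorm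
    have := hm k
    fun_prop
  have hG₁m : ∀ σ, Measurable (G₁ σ) := fun σ => by
    refine Measurable.iSup fun k => (Finset.measurable_sum _ fun i _ => ?_).enorm
    have := hm k
    fun_prop
  have hfst : MeasurePreserving (fun (ζ : Fin n → Z × Z) i => (ζ i).1) P₂ P :=
    measurePreserving_pi (fun _ => Q.prod Q) (fun _ => Q) fun _ => measurePreserving_fst
  have hsnd : MeasurePreserving (fun (ζ : Fin n → Z × Z) i => (ζ i).2) P₂ P :=
    measurePreserving_pi (fun _ => Q.prod Q) (fun _ => Q) fun _ => measurePreserving_snd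
  have hswap : ∀ σ, ∫⁻ ζ, G (fun _ => true) ζ ∂P₂ = ∫⁻ ζ, G σ ζ ∂P₂ := by
    intro σ
    have hs : MeasurePreserving
        (fun (ζ : Fin n → Z × Z) i => (if σ i then id else Prod.swap) (ζ i)) P₂ P₂ := by
      refine measurePreserving_pi (fun _ => Q.prod Q) (fun _ => Q.prod Q)
        (f := fun i => if σ i then id else Prod.swap) fun i => ?_
      split_ifs
      · exact MeasurePreserving.id _
      · exact Measure.measurePreserving_swap
    rw [← hs.lintegral_comp (hGm _)]
    refine lintegral_congr fun ζ => iSup_congr fun k => ?_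
    congr 1
    refine Finset.sum_congr rfl fun i _ => ?_
    by_cases hσ : σ i = true <;> simp [boolSign, hσ]
  have hsplit : ∀ σ, ∫⁻ ζ, G σ ζ ∂P₂ ≤ 2 * ∫⁻ ω, G₁ σ ω ∂P := by
    intro σ
    calc ∫⁻ ζ, G σ ζ ∂P₂
        ≤ ∫⁻ ζ, (G₁ σ (fun i => (ζ i).1) + G₁ σ (fun i => (ζ i).2)) ∂P₂ := by
          refine lintegral_mono fun ζ => iSup_le fun k => ?_
          simp only [mul_sub, Finset.sum_sub_distrib]
          refine enorm_sub_le.trans (add_le_add ?_ ?_)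
          · exact le_iSup (fun k => ‖∑ i, boolSign (σ i) * h k (ζ i).1‖ₑ) k
          · exact le_iSup (fun k => ‖∑ i, boolSign (σ i) * h k (ζ i).2‖ₑ) k
      _ = 2 * ∫⁻ ω, G₁ σ ω ∂P := by
          have hadd := lintegral_add_left (μ := P₂) ((hG₁m σ).comp hfst.measurable)
            (fun ζ => G₁ σ (fun i => (ζ i).2))
          simp only [Function.comp_apply] at hadd
          rw [hadd, hfst.lintegral_comp (hG₁m σ), hsnd.lintegral_comp (hG₁m σ), two_mul]
  have hghost : ∫⁻ ω, ⨆ k, ‖∑ i, (h k (ω i) - ∫ z, h k z ∂Q)‖ₑ ∂P ≤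
      ∫⁻ ζ, G (fun _ => true) ζ ∂P₂ := by
    have harrow := measurePreserving_arrowProdEquivProdArrow Z Z (Fin n) (fun _ => Q) (fun _ => Q)
    have hFm : Measurable fun p : (Fin n → Z) × (Fin n → Z) =>
        ⨆ k, ‖∑ i, (h k (p.1 i) - h k (p.2 i))‖ₑ := by
      refine Measurable.iSup fun k => (Finset.measurable_sum _ fun i _ => ?_).enorm
      have := hm k
      fun_prop
    have hF : ∫⁻ ζ, G (fun _ => true) ζ ∂P₂ =
        ∫⁻ ω, ∫⁻ ω', ⨆ k, ‖∑ i, (h k (ω i) - h k (ω' i))‖ₑ ∂P ∂P := by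
      rw [← lintegral_prod _ hFm.aemeasurable, ← harrow.lintegral_comp hFm]
      refine lintegral_congr fun ζ => iSup_congr fun k => ?_
      simp [boolSign, MeasurableEquiv.arrowProdEquivProdArrow, Equiv.arrowProdEquivProdArrow]
    rw [hF]
    refine lintegral_mono fun ω => iSup_le fun k => ?_
    have hev : ∀ i, MeasurePreserving (Function.eval i) P Q := fun i =>
      measurePreserving_eval (fun _ => Q) i
    have hint : ∀ i, Integrable (fun ω' : Fin n → Z => h k (ω' i)) P := fun i =>
      (hev i).integrable_comp_of_integrable (hi k)
    have hval : ∀ i, ∫ ω', h k (ω' i) ∂P = ∫ z, h k z ∂Q := fun i => by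
      rw [← (hev i).map_eq, integral_map (hev i).aemeasurable (hm k).aestronglyMeasurable]
    have heq : ∑ i, (h k (ω i) - ∫ z, h k z ∂Q) =
        ∫ ω', ∑ i, (h k (ω i) - h k (ω' i)) ∂P := by
      have hsub : ∀ i, Integrable (fun ω' : Fin n → Z => h k (ω i) - h k (ω' i)) P := fun i =>
        (integrable_const _).sub (hint i)
      rw [integral_finsetSum _ fun i _ => hsub i]
      refine Finset.sum_congr rfl fun i _ => ?_
      rw [integral_sub (integrable_const _) (hint i), hval]
      simp
    rw [heq]
    refine (enorm_integral_le_lintegral_enorm _).trans (lintegral_mono fun ω' => ?_)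
    exact le_iSup (fun k => ‖∑ i, (h k (ω i) - h k (ω' i))‖ₑ) k
  calc 2 ^ n * ∫⁻ ω, ⨆ k, ‖∑ i, (h k (ω i) - ∫ z, h k z ∂Q)‖ₑ ∂P
      ≤ 2 ^ n * ∫⁻ ζ, G (fun _ => true) ζ ∂P₂ := by gcongr
    _ = ∑ σ : Fin n → Bool, ∫⁻ ζ, G σ ζ ∂P₂ := by
        rw [← Finset.sum_congr rfl fun σ _ => hswap σ]
        simp
    _ ≤ ∑ σ : Fin n → Bool, 2 * ∫⁻ ω, G₁ σ ω ∂P := Finset.sum_le_sum fun σ _ => hsplit σ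
    _ = 2 * ∫⁻ ω, ∑ σ : Fin n → Bool, G₁ σ ω ∂P := by
        rw [← Finset.mul_sum, lintegral_finsetSum _ fun σ _ => hG₁m σ]

/-- The expected supremum of the threshold process weighted by `b` is of order `√n`. -/
lemma lintegral_iSup_threshold_le {Z : Type*} [MeasurableSpace Z]
    (Q : Measure Z) [IsProbabilityMeasure Q] {n : ℕ} (hn : 0 < n) (τ b : Z → ℝ)
    (hτ : Measurable τ) (hb : Measurable b) (hb2 : MemLp b 2 Q) :
    ∫⁻ ω, ⨆ q : ℚ, ‖∑ i, ((if (q : ℝ) < τ (ω i) then b (ω i) else 0) -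
        ∫ z, (if (q : ℝ) < τ z then b z else 0) ∂Q)‖ₑ ∂(Measure.pi fun _ : Fin n => Q) ≤
      ENNReal.ofReal (2 * (4 * ∫ z, b z ^ 2 ∂Q + 1) * √n) := by
  have hn' : (0 : ℝ) < n := by exact_mod_cast hn
  have hm : ∀ q : ℚ, Measurable fun z => if (q : ℝ) < τ z then b z else 0 := fun q =>
    Measurable.ite (measurableSet_lt measurable_const hτ) hb measurable_const
  have hi : ∀ q : ℚ, Integrable (fun z => if (q : ℝ) < τ z then b z else 0) Q := fun q => by
    refine (hb2.integrable one_le_two).mono (hm q).aestronglyMeasurable (ae_of_all _ fun z => ?_)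
    split_ifs <;> simp
  have hsym := lintegral_iSup_enorm_centered_le Q n
    (fun (q : ℚ) z => if (q : ℝ) < τ z then b z else 0) hm hi
  set P := Measure.pi fun _ : Fin n => Q
  have hev : ∀ i, MeasurePreserving (Function.eval i) P Q := fun i =>
    measurePreserving_eval (fun _ => Q) i
  have hint : ∀ i, Integrable (fun ω : Fin n → Z => b (ω i) ^ 2) P := fun i =>
    (hev i).integrable_comp_of_integrable (g := fun z => b z ^ 2) hb2.integrable_sq
  have hval : ∀ i, ∫ ω, b (ω i) ^ 2 ∂P = ∫ z, b z ^ 2 ∂Q := fun i => by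
    rw [← (hev i).map_eq, integral_map (hev i).aemeasurable (hb.pow_const 2).aestronglyMeasurable]
  have hsqrt : 0 < √(n : ℝ) := Real.sqrt_pos.2 hn'
  have hright : ∫⁻ ω, ∑ σ : Fin n → Bool, ⨆ q : ℚ,
      ‖∑ i, boolSign (σ i) * (if (q : ℝ) < τ (ω i) then b (ω i) else 0)‖ₑ ∂P ≤
      2 ^ n * ENNReal.ofReal ((4 * ∫ z, b z ^ 2 ∂Q + 1) * √n) := by
    have hpt := fun ω : Fin n → Z => sum_iSup_enorm_rademacher_le (fun i => τ (ω i))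
      (fun i => b (ω i)) (fun q : ℚ => (q : ℝ)) hsqrt
    refine (lintegral_mono hpt).trans ?_
    rw [lintegral_const_mul' _ _ (ENNReal.pow_ne_top ENNReal.ofNat_ne_top), Fintype.card_fin]
    refine mul_le_mul_right ?_ _
    have hI : Integrable (fun ω : Fin n → Z => 4 * (∑ i, b (ω i) ^ 2) / √n + √n) P :=
      (((integrable_finsetSum _ fun i _ => hint i).const_mul 4).div_const _).add
        (integrable_const _)
    rw [← ofReal_integral_eq_lintegral_ofReal hI (ae_of_all _ fun ω => by positivity)]
    refine ENNReal.ofReal_le_ofReal (le_of_eq ?_)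
    rw [integral_add (((integrable_finsetSum _ fun i _ => hint i).const_mul 4).div_const _)
      (integrable_const _), integral_div, integral_const_mul,
      integral_finsetSum _ fun i _ => hint i]
    simp only [hval, Finset.sum_const, Finset.card_univ, Fintype.card_fin, nsmul_eq_mul,
      integral_const, probReal_univ, one_smul]
    have : (√(n : ℝ)) ^ 2 = n := Real.sq_sqrt hn'.le
    field_simp
    linear_combination (-4 * ∫ z, b z ^ 2 ∂Q) * this
  have h2 : (2 : ENNReal) ^ n ≠ 0 := by simp
  have h2' : (2 : ENNReal) ^ n ≠ ⊤ := by simp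
  rw [← ENNReal.mul_le_mul_iff_right h2 h2']
  refine hsym.trans ((mul_le_mul_right hright 2).trans (le_of_eq ?_))
  rw [mul_left_comm, mul_assoc (2 : ℝ), ENNReal.ofReal_mul zero_le_two]
  simp

lemma tendsto_ite_lt_nhdsGT (t s c : ℝ) :
    Filter.Tendsto (fun u : ℝ => if u < s then c else 0) (nhdsWithin t (Set.Ioi t))
      (nhds (if t < s then c else 0)) := by
  refine tendsto_const_nhds.congr' ?_
  by_cases h : t < s
  · filter_upwards [nhdsWithin_le_nhds (Iio_mem_nhds h)] with u hu
    rw [if_pos h, if_pos (Set.mem_Iio.1 hu)]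
  · filter_upwards [self_mem_nhdsWithin] with u hu
    rw [if_neg h, if_neg (not_lt.2 ((not_lt.1 h).trans (le_of_lt hu)))]

/-- Tail bound, at the rate `n^{-1/2}`, for the threshold process weighted by `b`. -/
lemma measure_threshold_deviation_le {Z : Type*} [MeasurableSpace Z]
    (Q : Measure Z) [IsProbabilityMeasure Q] {n : ℕ} (hn : 0 < n) (τ b : Z → ℝ)
    (hτ : Measurable τ) (hb : Measurable b) (hb2 : MemLp b 2 Q) {M : ℝ} (hM : 0 < M) :
    (Measure.pi fun _ : Fin n => Q) {ω | ∃ t : ℝ, M * (n : ℝ) ^ (-(1 : ℝ) / 2) <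
        |(n : ℝ)⁻¹ * ∑ i, (if t < τ (ω i) then b (ω i) else 0) -
          ∫ z, (if t < τ z then b z else 0) ∂Q|} ≤
      ENNReal.ofReal (2 * (4 * ∫ z, b z ^ 2 ∂Q + 1) / M) := by
  have hn' : (0 : ℝ) < n := by exact_mod_cast hn
  have hsqrt : 0 < √(n : ℝ) := Real.sqrt_pos.2 hn'
  have hrate : (n : ℝ) * (n : ℝ) ^ (-(1 : ℝ) / 2) = √n := by
    nth_rewrite 1 [← Real.rpow_one (n : ℝ)]
    rw [← Real.rpow_add hn', Real.sqrt_eq_rpow]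
    norm_num
  have hm : ∀ t : ℝ, Measurable fun z => if t < τ z then b z else 0 := fun t =>
    Measurable.ite (measurableSet_lt measurable_const hτ) hb measurable_const
  set V : (Fin n → Z) → ENNReal := fun ω =>
    ⨆ q : ℚ, ‖∑ i, ((if (q : ℝ) < τ (ω i) then b (ω i) else 0) -
        ∫ z, (if (q : ℝ) < τ z then b z else 0) ∂Q)‖ₑ
  have hVm : Measurable V := by
    refine Measurable.iSup fun q => (Finset.measurable_sum _ fun i _ => ?_).enorm
    exact ((hm q).comp (measurable_pi_apply i)).sub_const _
  have hsub : {ω : Fin n → Z | ∃ t : ℝ, M * (n : ℝ) ^ (-(1 : ℝ) / 2) <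
        |(n : ℝ)⁻¹ * ∑ i, (if t < τ (ω i) then b (ω i) else 0) -
          ∫ z, (if t < τ z then b z else 0) ∂Q|} ⊆ {ω | ENNReal.ofReal (M * √n) ≤ V ω} := by
    rintro ω ⟨t, ht⟩
    have hlim : Filter.Tendsto (fun u : ℝ =>
        |(n : ℝ)⁻¹ * ∑ i, (if u < τ (ω i) then b (ω i) else 0) -
          ∫ z, (if u < τ z then b z else 0) ∂Q|) (nhdsWithin t (Set.Ioi t))
        (nhds |(n : ℝ)⁻¹ * ∑ i, (if t < τ (ω i) then b (ω i) else 0) -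
          ∫ z, (if t < τ z then b z else 0) ∂Q|) := by
      refine (((tendsto_finsetSum _ fun i _ => tendsto_ite_lt_nhdsGT t _ _).const_mul _).sub
        ?_).abs
      refine tendsto_integral_filter_of_dominated_convergence (fun z => |b z|)
        (Filter.Eventually.of_forall fun u => (hm u).aestronglyMeasurable)
        (Filter.Eventually.of_forall fun u => ae_of_all _ fun z => ?_)
        (hb2.integrable one_le_two).abs (ae_of_all _ fun z => tendsto_ite_lt_nhdsGT t _ _)
      split_ifs <;> simp
    obtain ⟨u, hu, hsubset⟩ := mem_nhdsGT_iff_exists_Ioo_subset.1 (hlim.eventually (lt_mem_nhds ht))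
    obtain ⟨q, hq₁, hq₂⟩ := exists_rat_btwn (Set.mem_Ioi.1 hu)
    have hq := hsubset ⟨hq₁, hq₂⟩
    rw [Set.mem_ofPred_eq] at hq
    refine le_trans ?_ (le_iSup (fun q : ℚ => ‖∑ i, ((if (q : ℝ) < τ (ω i) then b (ω i) else 0) -
        ∫ z, (if (q : ℝ) < τ z then b z else 0) ∂Q)‖ₑ) q)
    rw [Real.enorm_eq_ofReal_abs]
    refine ENNReal.ofReal_le_ofReal ?_
    have hscale : |∑ i, ((if (q : ℝ) < τ (ω i) then b (ω i) else 0) -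
        ∫ z, (if (q : ℝ) < τ z then b z else 0) ∂Q)| =
        n * |(n : ℝ)⁻¹ * ∑ i, (if (q : ℝ) < τ (ω i) then b (ω i) else 0) -
          ∫ z, (if (q : ℝ) < τ z then b z else 0) ∂Q| := by
      rw [← abs_of_pos hn', ← abs_mul, abs_of_pos hn', mul_sub, mul_inv_cancel_left₀ hn'.ne',
        Finset.sum_sub_distrib]
      simp
    rw [hscale, ← hrate, mul_left_comm]
    exact (mul_le_mul_of_nonneg_left hq.le hn'.le)
  have hpos : 0 < M * √n := mul_pos hM hsqrt
  refine (measure_mono hsub).trans ((meas_ge_le_lintegral_div hVm.aemeasurable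
    (ENNReal.ofReal_pos.2 hpos).ne' ENNReal.ofReal_ne_top).trans ?_)
  refine (ENNReal.div_le_div_right (lintegral_iSup_threshold_le Q hn τ b hτ hb hb2) _).trans ?_
  rw [← ENNReal.ofReal_div_of_pos hpos, mul_div_mul_right _ _ hsqrt.ne']

/-- Uniform convergence of the empirical doubly robust value
estimates over all threshold policies, at the parametric rate:
`sup_{g∈(0,1)} |n⁻¹ Σ_i f_g(X_i,W_i,Y_i) − μ(π^g)| = O_p(n^{-1/2})`. -/
theorem dr_threshold_class_uniform_deviation
    {𝒳 : Type*} [MeasurableSpace 𝒳] (PX : Measure 𝒳) [IsProbabilityMeasure PX]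
    (Q : Measure (𝒳 × Bool × ℝ)) [IsProbabilityMeasure Q]
    (hQX : Q.map Prod.fst = PX)
    (ν : ℝ) (hν : ν ∈ Set.Ioc (0:ℝ) (1/2))
    (e : 𝒳 → ℝ) (he_meas : Measurable e)
    (he_bdd : ∀ x, e x ∈ Set.Icc ν (1 - ν))
    -- `P(W = 1 | X) = e(X)` a.s., stated in integral form
    (hprop : ∀ h : 𝒳 → ℝ, Measurable h → (∃ C, ∀ x, |h x| ≤ C) →
      ∫ z, (if z.2.1 then (1:ℝ) else 0) * h z.1 ∂Q = ∫ z, e z.1 * h z.1 ∂Q)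
    (η : Bool → 𝒳 → ℝ) (hη_meas : ∀ w, Measurable (η w))
    (Bη : ℝ) (hη_bdd : ∀ w x, |η w x| ≤ Bη)
    -- `E[Y | W, X] = η(W,X)` a.s., stated in integral form
    (hreg : ∀ h : Bool → 𝒳 → ℝ, (∀ w, Measurable (h w)) →
      (∃ C, ∀ w x, |h w x| ≤ C) →
      ∫ z, z.2.2 * h z.2.1 z.1 ∂Q = ∫ z, η z.2.1 z.1 * h z.2.1 z.1 ∂Q)
    (B : ℝ) (hY_bdd : ∀ᵐ z ∂Q, |z.2.2| ≤ B)
    (τ : 𝒳 → ℝ) (hτ_meas : Measurable τ)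
    (hτ_atomless : ∀ t : ℝ, PX {x | τ x = t} = 0) :
    ∀ ε : ℝ, 0 < ε → ∃ (M : ℝ) (N : ℕ), ∀ n ≥ N,
      (Measure.pi fun _ : Fin n => Q)
          {ω : Fin n → 𝒳 × Bool × ℝ |
            M * (n : ℝ) ^ (-(1:ℝ)/2) <
              ⨆ g : Set.Ioo (0:ℝ) 1,
                |(n : ℝ)⁻¹ * ∑ i : Fin n, drScoreThr PX e η τ (g : ℝ) (ω i) -
                  ∫ x, (thrPol PX τ (g : ℝ) x * η true x +
                    (1 - thrPol PX τ (g : ℝ) x) * η false x) ∂PX|}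
        ≤ ENNReal.ofReal ε := by
  set W : 𝒳 × Bool × ℝ → ℝ := fun z => if z.2.1 then e z.1 else 1 - e z.1 with hW
  set r : 𝒳 × Bool × ℝ → ℝ := fun z => z.2.2 - η z.2.1 z.1 with hr
  set a : 𝒳 × Bool × ℝ → ℝ := fun z =>
    η false z.1 + (if z.2.1 then 0 else 1) / W z * r z with ha
  set b : 𝒳 × Bool × ℝ → ℝ := fun z =>
    (η true z.1 - η false z.1) + (if z.2.1 then 1 else -1) / W z * r z with hb
  have hbool : MeasurableSet {z : 𝒳 × Bool × ℝ | z.2.1 = true} :=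
    measurable_snd.fst (measurableSet_singleton true)
  have hW_ge : ∀ z, ν ≤ W z := fun z => by
    have := he_bdd z.1
    simp only [hW]
    split_ifs
    · exact this.1
    · linarith [this.2]
  have hW_meas : Measurable W :=
    Measurable.ite hbool (he_meas.comp measurable_fst)
      ((he_meas.comp measurable_fst).const_sub 1)
  have hηz_meas : Measurable fun z : 𝒳 × Bool × ℝ => η z.2.1 z.1 := by
    have : (fun z : 𝒳 × Bool × ℝ => η z.2.1 z.1) =
        fun z => if z.2.1 = true then η true z.1 else η false z.1 := by
      funext z
      cases z.2.1 <;> simp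
    rw [this]
    exact Measurable.ite hbool ((hη_meas true).comp measurable_fst)
      ((hη_meas false).comp measurable_fst)
  have hr_meas : Measurable r := measurable_snd.snd.sub hηz_meas
  have hr_bdd : ∀ᵐ z ∂Q, |r z| ≤ B + Bη := by
    filter_upwards [hY_bdd] with z hz
    exact (abs_sub _ _).trans (add_le_add hz (hη_bdd _ _))
  have hquot : ∀ c z, |c| ≤ 1 → |c / W z| ≤ ν⁻¹ := fun c z hc => by
    rw [abs_div, abs_of_pos (hν.1.trans_le (hW_ge z)), ← one_div]
    exact div_le_div₀ zero_le_one hc hν.1 (hW_ge z)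
  have hresid : ∀ c z, |c| ≤ 1 → |r z| ≤ B + Bη → |c / W z * r z| ≤ ν⁻¹ * (B + Bη) :=
    fun c z hc hz => by
      rw [abs_mul]
      exact mul_le_mul (hquot c z hc) hz (abs_nonneg _) (inv_nonneg.2 hν.1.le)
  have ha_meas : Measurable a :=
    ((hη_meas false).comp measurable_fst).add
      (((Measurable.ite hbool measurable_const measurable_const).div hW_meas).mul hr_meas)
  have hb_meas : Measurable b :=
    (((hη_meas true).comp measurable_fst).sub ((hη_meas false).comp measurable_fst)).add
      (((Measurable.ite hbool measurable_const measurable_const).div hW_meas).mul hr_meas)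
  have ha2 : MemLp a 2 Q := by
    refine MemLp.of_bound ha_meas.aestronglyMeasurable (Bη + ν⁻¹ * (B + Bη)) ?_
    filter_upwards [hr_bdd] with z hz
    rw [Real.norm_eq_abs]
    refine (abs_add_le _ _).trans (add_le_add (hη_bdd _ _) (hresid _ _ ?_ hz))
    split_ifs <;> simp
  have hb2 : MemLp b 2 Q := by
    refine MemLp.of_bound hb_meas.aestronglyMeasurable ((Bη + Bη) + ν⁻¹ * (B + Bη)) ?_
    filter_upwards [hr_bdd] with z hz
    rw [Real.norm_eq_abs]
    refine (abs_add_le _ _).trans (add_le_add ?_ (hresid _ _ ?_ hz))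
    · exact (abs_sub _ _).trans (add_le_add (hη_bdd _ _) (hη_bdd _ _))
    · split_ifs <;> simp
  have ha1 : Integrable a Q := ha2.integrable one_le_two
  have hthr_meas : ∀ t : ℝ,
      Measurable fun z : 𝒳 × Bool × ℝ => if t < τ z.1 then b z else 0 := fun t =>
    Measurable.ite (measurableSet_lt measurable_const (hτ_meas.comp measurable_fst)) hb_meas
      measurable_const
  have hthr_int : ∀ t : ℝ,
      Integrable (fun z : 𝒳 × Bool × ℝ => if t < τ z.1 then b z else 0) Q := fun t => by
    refine (hb2.integrable one_le_two).mono (hthr_meas t).aestronglyMeasurable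
      (ae_of_all _ fun z => ?_)
    split_ifs <;> simp
  have hscore : ∀ g z, drScoreThr PX e η τ g z =
      a z + if quantileOf PX τ (1 - g) < τ z.1 then b z else 0 := fun g z => by
    simp only [drScoreThr, thrPol, ha, hb, hW, hr]
    split_ifs <;> ring
  have hmean : ∀ g : ℝ, ∫ x, (thrPol PX τ g x * η true x + (1 - thrPol PX τ g x) * η false x) ∂PX =
      ∫ z, a z ∂Q + ∫ z, (if quantileOf PX τ (1 - g) < τ z.1 then b z else 0) ∂Q := by
    intro g
    have hπ_meas : Measurable (thrPol PX τ g) :=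
      Measurable.ite (measurableSet_lt measurable_const hτ_meas) measurable_const measurable_const
    have hπ_bdd : ∀ w x, |if w = true then thrPol PX τ g x else 1 - thrPol PX τ g x| ≤ 1 :=
      fun w x => by
        simp only [thrPol]
        split_ifs <;> simp
    have hηπ_meas : Measurable fun x =>
        thrPol PX τ g x * η true x + (1 - thrPol PX τ g x) * η false x :=
      (hπ_meas.mul (hη_meas true)).add ((hπ_meas.const_sub 1).mul (hη_meas false))
    set H : Bool → 𝒳 → ℝ := fun w x =>
      (if w then thrPol PX τ g x else 1 - thrPol PX τ g x) / (if w then e x else 1 - e x) with hH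
    have hH_meas : ∀ w, Measurable (H w) := fun w => by
      cases w
      · exact (hπ_meas.const_sub 1).div (he_meas.const_sub 1)
      · exact hπ_meas.div he_meas
    have hH_bdd : ∀ w x, |H w x| ≤ ν⁻¹ := fun w x => hquot _ (x, w, 0) (hπ_bdd w x)
    have hHz_meas : Measurable fun z : 𝒳 × Bool × ℝ => H z.2.1 z.1 :=
      (Measurable.ite hbool (hπ_meas.comp measurable_fst)
        ((hπ_meas.comp measurable_fst).const_sub 1)).div hW_meas
    have hcross := hreg H hH_meas ⟨_, hH_bdd⟩
    have hYint : Integrable (fun z : 𝒳 × Bool × ℝ => z.2.2 * H z.2.1 z.1) Q := by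
      refine Integrable.of_bound (measurable_snd.snd.mul hHz_meas).aestronglyMeasurable
        (B * ν⁻¹) ?_
      filter_upwards [hY_bdd] with z hz
      rw [Real.norm_eq_abs, abs_mul]
      exact mul_le_mul hz (hH_bdd _ _) (abs_nonneg _) ((abs_nonneg _).trans hz)
    have hηint : Integrable (fun z : 𝒳 × Bool × ℝ => η z.2.1 z.1 * H z.2.1 z.1) Q := by
      refine Integrable.of_bound (hηz_meas.mul hHz_meas).aestronglyMeasurable
        (Bη * ν⁻¹) (ae_of_all _ fun z => ?_)
      rw [Real.norm_eq_abs, abs_mul]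
      exact mul_le_mul (hη_bdd _ _) (hH_bdd _ _) (abs_nonneg _)
        ((abs_nonneg _).trans (hη_bdd z.2.1 z.1))
    have hsum : ∀ z : 𝒳 × Bool × ℝ,
        thrPol PX τ g z.1 * η true z.1 + (1 - thrPol PX τ g z.1) * η false z.1 =
        (a z + if quantileOf PX τ (1 - g) < τ z.1 then b z else 0) -
          (z.2.2 * H z.2.1 z.1 - η z.2.1 z.1 * H z.2.1 z.1) := fun z => by
      rw [← hscore]
      simp only [drScoreThr, hH]
      ring
    rw [← hQX, integral_map measurable_fst.aemeasurable
      (by rw [hQX]; exact hηπ_meas.aestronglyMeasurable), hQX, integral_congr_ae (ae_of_all _ hsum)]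
    refine (integral_sub (ha1.add (hthr_int _)) (hYint.sub hηint)).trans ?_
    rw [integral_sub' hYint hηint, hcross, sub_self, sub_zero]
    exact integral_add ha1 (hthr_int _)
  intro ε hε
  set Ka : ℝ := 2 * (4 * ∫ z, a z ^ 2 ∂Q + 1) with hKa
  set Kb : ℝ := 2 * (4 * ∫ z, b z ^ 2 ∂Q + 1) with hKb
  have hKa0 : 0 < Ka := by
    have : 0 ≤ ∫ z, a z ^ 2 ∂Q := integral_nonneg fun z => sq_nonneg _
    positivity
  have hKb0 : 0 < Kb := by
    have : 0 ≤ ∫ z, b z ^ 2 ∂Q := integral_nonneg fun z => sq_nonneg _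
    positivity
  set M : ℝ := (Ka + Kb) / ε with hM
  have hM0 : 0 < M := by positivity
  refine ⟨2 * M, 1, fun n hn => ?_⟩
  have : Nonempty (Set.Ioo (0 : ℝ) 1) := ⟨⟨1 / 2, by norm_num, by norm_num⟩⟩
  have hA := measure_threshold_deviation_le Q hn (fun _ => 0) a measurable_const ha_meas ha2 hM0
  have hB := measure_threshold_deviation_le Q hn (fun z => τ z.1) b
    (hτ_meas.comp measurable_fst) hb_meas hb2 hM0
  refine (measure_mono ?_).trans ((measure_union_le _ _).trans ((add_le_add hA hB).trans ?_))
  · intro ω hω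
    rw [Set.mem_ofPred_eq] at hω
    obtain ⟨g, hg⟩ := exists_lt_of_lt_ciSup hω
    rw [hmean] at hg
    simp only [hscore, Finset.sum_add_distrib] at hg
    by_contra hcon
    simp only [Set.mem_union, Set.mem_ofPred_eq, not_or, not_exists, not_lt] at hcon
    have h1 := hcon.1 (-1)
    have h2 := hcon.2 (quantileOf PX τ (1 - g))
    simp only [neg_lt_zero, zero_lt_one, if_true] at h1
    have h3 := abs_add_le ((n : ℝ)⁻¹ * ∑ i, a (ω i) - ∫ z, a z ∂Q)
      ((n : ℝ)⁻¹ * ∑ i, (if quantileOf PX τ (1 - g) < τ (ω i).1 then b (ω i) else 0) -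
        ∫ z, (if quantileOf PX τ (1 - g) < τ z.1 then b z else 0) ∂Q)
    rw [sub_add_sub_comm, ← mul_add] at h3
    linarith
  · rw [← ENNReal.ofReal_add (by positivity) (by positivity), ← add_div]
    refine ENNReal.ofReal_le_ofReal (le_of_eq ?_)
    rw [hM, ← hKa, ← hKb]
    field_simp
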